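/- Let i > j be positive integers and let Γ be a finite connected directed multigraph with a positive balanced weight containing distinct vertices a, b, c, d and two distinguished edges: an edge from c to b of weight i and an edge from d to a of weight j. Let Γ_1 be the graph obtained from Γ by deleting these two edges and adding two new vertices v_1, v_2 together with edges c→v_2 of weight i, v_2→a of weight j, d→v_1 of weight j, v_1→b of weight i, and v_2→v_1 of weight i−j. Let Γ_2 be the graph obtained from Γ by deleting the two distinguished edges and adding two new vertices v_1, v_2 together with edges c→v_1 of weight i, d→v_1 of weight j, v_1→v_2 of weight i+j, v_2→a of weight j, and v_2→b of weight i. Then for every root r chosen among the vertices of Γ: i·j·(i+j) · N(Γ, r) = −(i+j) · N(Γ_1, r) + i · N(Γ_2, r), i.e., N(Γ, r) = (−1/(i·j)) · N(Γ_1, r) + (1/(j·(i+j))) · N(Γ_2, r). -/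

import Mathlib

/-- A finite directed multigraph on vertex type `V` with edge type `E`. -/
structure Multidigraph (V E : Type) where
  src : E → V
  tgt : E → V

/-- `T` is an oriented spanning tree of `G` rooted at `r`: every vertex `v ≠ r`
has in-degree 1 in `T`, the root `r` has in-degree 0 in `T`, and `T` contains
no oriented cycle. -/
def IsOrientedSpanningTree {V E : Type} [Fintype E] [DecidableEq V]
    (G : Multidigraph V E) (r : V) (T : Finset E) : Prop :=
  (∀ v : V, v ≠ r → (T.filter (fun e => G.tgt e = v)).card = 1) ∧
  (T.filter (fun e => G.tgt e = r)).card = 0 ∧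
  ¬ ∃ l : List E, l ≠ [] ∧ (∀ e ∈ l, e ∈ T) ∧
      l.Chain' (fun e f => G.tgt e = G.src f) ∧
      ∀ e₁ ∈ l.head?, ∀ e₂ ∈ l.getLast?, G.tgt e₂ = G.src e₁

open Classical in
/-- The weighted number `N(Γ, w, r)` of oriented spanning trees rooted at `r`. -/
noncomputable def treeCount {V E : Type} [Fintype E] [DecidableEq V]
    (G : Multidigraph V E) (w : E → ℤ) (r : V) : ℤ :=
  ∑ T : Finset E, if IsOrientedSpanningTree G r T then ∏ e ∈ T, w e else 0


/-- Undirected connectivity of the underlying undirected graph. -/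
def MConnected {V E : Type} (G : Multidigraph V E) : Prop :=
  ∀ u v : V, Relation.ReflTransGen
    (fun x y => ∃ e : E, (G.src e = x ∧ G.tgt e = y) ∨ (G.src e = y ∧ G.tgt e = x)) u v

/-- A weight is balanced if at each vertex the incoming and outgoing weights agree. -/
def IsBalanced {V E : Type} [Fintype E] [DecidableEq V]
    (G : Multidigraph V E) (w : E → ℤ) : Prop :=
  ∀ v : V, ∑ e ∈ Finset.univ.filter (fun e => G.tgt e = v), w e
         = ∑ e ∈ Finset.univ.filter (fun e => G.src e = v), w e

section Skein

variable {V E : Type} [DecidableEq E]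

/-- The graph `Γ₁` (for the case `i > j`): delete the two distinguished edges
`e₁ : c → b` and `e₂ : d → a`, add two new vertices `v₁ = Sum.inr 0` and
`v₂ = Sum.inr 1`, and add edges `c → v₂`, `v₂ → a`, `d → v₁`, `v₁ → b`, and
`v₂ → v₁`. -/
def Gamma1 (G : Multidigraph V E) (e₁ e₂ : E) (a b c d : V) :
    Multidigraph (V ⊕ Fin 2) ({e : E // e ≠ e₁ ∧ e ≠ e₂} ⊕ Fin 5) where
  src := Sum.elim (fun e => Sum.inl (G.src e.1))
    ![Sum.inl c, Sum.inr 1, Sum.inl d, Sum.inr 0, Sum.inr 1]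
  tgt := Sum.elim (fun e => Sum.inl (G.tgt e.1))
    ![Sum.inr 1, Sum.inl a, Sum.inr 0, Sum.inl b, Sum.inr 0]

/-- The weight on `Γ₁` for the case `i > j`: old edges keep their weight, the new
edges `c → v₂`, `v₂ → a`, `d → v₁`, `v₁ → b`, `v₂ → v₁` have weights
`i, j, j, i, i - j`. -/
def weight1 (w : E → ℤ) (e₁ e₂ : E) (i j : ℤ) :
    ({e : E // e ≠ e₁ ∧ e ≠ e₂} ⊕ Fin 5) → ℤ :=
  Sum.elim (fun e => w e.1) ![i, j, j, i, i - j]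

/-- The graph `Γ₂`: delete the two distinguished edges `e₁ : c → b` and
`e₂ : d → a`, add two new vertices `v₁ = Sum.inr 0` and `v₂ = Sum.inr 1`, and add
edges `c → v₁`, `d → v₁`, `v₁ → v₂`, `v₂ → a`, `v₂ → b`. -/
def Gamma2 (G : Multidigraph V E) (e₁ e₂ : E) (a b c d : V) :
    Multidigraph (V ⊕ Fin 2) ({e : E // e ≠ e₁ ∧ e ≠ e₂} ⊕ Fin 5) where
  src := Sum.elim (fun e => Sum.inl (G.src e.1))
    ![Sum.inl c, Sum.inl d, Sum.inr 0, Sum.inr 1, Sum.inr 1]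
  tgt := Sum.elim (fun e => Sum.inl (G.tgt e.1))
    ![Sum.inr 0, Sum.inr 0, Sum.inr 1, Sum.inl a, Sum.inl b]

/-- The weight on `Γ₂`: old edges keep their weight, and the new edges
`c → v₁`, `d → v₁`, `v₁ → v₂`, `v₂ → a`, `v₂ → b` have weights `i, j, i+j, j, i`. -/
def weight2 (w : E → ℤ) (e₁ e₂ : E) (i j : ℤ) :
    ({e : E // e ≠ e₁ ∧ e ≠ e₂} ⊕ Fin 5) → ℤ :=
  Sum.elim (fun e => w e.1) ![i, j, i + j, j, i]

end Skein


section Helpers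

open Finset

/-- The transfer matrix of a parent function. -/
def parMat {V : Type} [DecidableEq V] (r : V) (p : V → V) : Matrix V V ℚ :=
  Matrix.of fun v u => if v ≠ r ∧ u = p v then 1 else 0

lemma parMat_det_one {V : Type} [Fintype V] [DecidableEq V] (r : V) (p : V → V)
    (h : V → ℕ) (hh : ∀ v, v ≠ r → h (p v) < h v) :
    (1 - parMat r p).det = 1 := by
  have key : ∀ k v u, h v < k → (parMat r p ^ k) v u = 0 := by
    intro k
    induction k with
    | zero => intro v u hv; omega
    | succ k ih =>
      intro v u hv
      rw [pow_succ', Matrix.mul_apply]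
      apply Finset.sum_eq_zero
      intro x _
      by_cases hx : v ≠ r ∧ x = p v
      · rw [ih x u, mul_zero]
        have := hh v hx.1
        rw [hx.2]; omega
      · simp [parMat, hx]
  have hnil : IsNilpotent (parMat r p) := by
    refine ⟨(∑ v, h v) + 1, ?_⟩
    ext v u
    apply key
    exact Nat.lt_succ_of_le (Finset.single_le_sum (f := h) (fun _ _ => Nat.zero_le _) (mem_univ v))
  have h1 := Matrix.isNilpotent_charpoly_sub_pow_of_isNilpotent hnil
  have h2 := h1.eq_zero
  have h3 : (parMat r p).charpoly = Polynomial.X ^ Fintype.card V := sub_eq_zero.mp h2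
  have h4 := Matrix.eval_charpoly (parMat r p) 1
  rw [h3] at h4
  simpa using h4.symm

lemma parMat_det_zero {V : Type} [Fintype V] [DecidableEq V] (r : V) (p : V → V)
    (v₀ : V) (hv : ∀ k, p^[k] v₀ ≠ r) :
    (1 - parMat r p).det = 0 := by
  classical
  rw [← Matrix.exists_mulVec_eq_zero_iff]
  refine ⟨fun v => if ∃ k, p^[k] v = r then 0 else 1, ?_, ?_⟩
  · intro h0
    have := congrFun h0 v₀
    simp [hv] at this
  · ext v
    rw [Matrix.sub_mulVec, Matrix.one_mulVec]
    simp only [Pi.sub_apply, Pi.zero_apply, Matrix.mulVec, dotProduct, parMat, Matrix.of_apply]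
    by_cases hr : v = r
    · have : ∃ k, p^[k] v = r := ⟨0, hr⟩
      simp [hr]
      exact ⟨0, rfl⟩
    · have : (∃ k, p^[k] v = r) ↔ ∃ k, p^[k] (p v) = r := by
        constructor
        · rintro ⟨k, hk⟩
          cases k with
          | zero => exact absurd hk hr
          | succ k => exact ⟨k, hk⟩
        · rintro ⟨k, hk⟩; exact ⟨k+1, hk⟩
      simp only [this, ne_eq, hr, not_false_eq_true, true_and, ite_mul, one_mul, zero_mul,
        Finset.sum_ite_eq', mem_univ, if_true, sub_self]

/-- The modified Laplacian. -/
def lapM {V E : Type} [Fintype E] [DecidableEq V] (G : Multidigraph V E) (w : E → ℚ) (r : V) :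
    Matrix V V ℚ :=
  Matrix.of fun v u => if v = r then (if u = r then 1 else 0) else
    ∑ e, if G.tgt e = v then w e * ((if u = v then 1 else 0) - (if u = G.src e then 1 else 0)) else 0

/-- No oriented cycle, as in the definition of spanning trees. -/
def Acyc {V E : Type} (G : Multidigraph V E) (T : Finset E) : Prop :=
  ¬ ∃ l : List E, l ≠ [] ∧ (∀ e ∈ l, e ∈ T) ∧
      l.IsChain (fun e f => G.tgt e = G.src f) ∧
      ∀ e₁ ∈ l.head?, ∀ e₂ ∈ l.getLast?, G.tgt e₂ = G.src e₁

lemma chain_height {V E : Type} (G : Multidigraph V E) (h : V → ℕ) (l : List E) :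
    ∀ (hl : l ≠ []), (∀ e ∈ l, h (G.src e) < h (G.tgt e)) →
      l.IsChain (fun e f => G.tgt e = G.src f) →
      h (G.src (l.head hl)) < h (G.tgt (l.getLast hl)) := by
  induction l with
  | nil => intro hl; exact absurd rfl hl
  | cons x l ih =>
    intro hl hlt hc
    cases l with
    | nil => simpa using hlt x (by simp)
    | cons y l =>
      have h1 := ih (by simp) (fun e he => hlt e (List.mem_cons_of_mem _ he)) hc.tail
      have h2 : G.tgt x = G.src y := (List.isChain_cons_cons.mp hc).1
      have h3 := hlt x (by simp)
      simp only [List.head_cons] at h1 ⊢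
      rw [List.getLast_cons (by simp)]
      rw [h2] at h3
      omega

/-- det of the unweighted matrix detects acyclicity -/
lemma det_acyc {V E : Type} [Fintype V] [DecidableEq V] (G : Multidigraph V E)
    (r : V) (T : Finset E) (p : V → V) (hpr : p r = r)
    (hT : ∀ e ∈ T, G.tgt e ≠ r ∧ p (G.tgt e) = G.src e)
    (hT' : ∀ v, v ≠ r → ∃ e ∈ T, G.tgt e = v) [Decidable (Acyc G T)] :
    (1 - parMat r p).det = if Acyc G T then 1 else 0 := by
  classical
  by_cases hall : ∀ v, ∃ k, p^[k] v = r
  · have hlt : ∀ v, v ≠ r → Nat.find (hall (p v)) < Nat.find (hall v) := by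
      intro v hv
      have h0 := Nat.find_spec (hall v)
      obtain ⟨m, hm⟩ : ∃ m, Nat.find (hall v) = m + 1 := by
        cases hk : Nat.find (hall v) with
        | zero => rw [hk] at h0; exact absurd h0 hv
        | succ m => exact ⟨m, rfl⟩
      rw [hm] at h0 ⊢
      exact Nat.lt_succ_of_le (Nat.find_min' _ h0)
    rw [parMat_det_one r p (fun v => Nat.find (hall v)) hlt, if_pos]
    rintro ⟨l, hl, hmem, hc, hcl⟩
    have := chain_height G (fun v => Nat.find (hall v)) l hl (fun e he => by
      obtain ⟨h1, h2⟩ := hT e (hmem e he)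
      have := hlt _ h1
      simp only [h2] at this
      exact this) hc
    have h5 := hcl (l.head hl) (List.head_mem_head? hl) (l.getLast hl) (List.getLast_mem_getLast? hl)
    rw [h5] at this
    exact lt_irrefl _ this
  · push Not at hall
    obtain ⟨v, hv⟩ := hall
    rw [parMat_det_zero r p v hv, if_neg]
    intro hac
    apply hac
    obtain ⟨m, n, hmn, heq⟩ := Finite.exists_ne_map_eq_of_infinite (fun k : ℕ => p^[k] v)
    wlog hlt : m < n generalizing m n with H
    · exact H n m hmn.symm heq.symm (by omega)
    have hE : Nonempty E := ⟨(hT' v (hv 0)).choose⟩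
    choose! f hf using hT'
    have hf1 : ∀ k, f (p^[k] v) ∈ T := fun k => (hf _ (hv k)).1
    have hf2 : ∀ k, G.tgt (f (p^[k] v)) = p^[k] v := fun k => (hf _ (hv k)).2
    have hf3 : ∀ k, G.src (f (p^[k] v)) = p^[k+1] v := fun k => by
      rw [← (hT _ (hf1 k)).2, hf2, Function.iterate_succ_apply']
    obtain ⟨s, rfl⟩ : ∃ s, n = m + s + 1 := ⟨n - m - 1, by omega⟩
    have aux : ∀ s, ∃ l : List E, ∃ hl : l ≠ [], (∀ e ∈ l, e ∈ T) ∧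
        l.IsChain (fun e f => G.tgt e = G.src f) ∧ G.src (l.head hl) = p^[m+s+1] v ∧
          G.tgt (l.getLast hl) = p^[m] v := by
      intro s
      induction s with
      | zero => exact ⟨[f (p^[m] v)], by simp, by simpa using hf1 m, by simp, by simp [hf3], by simp [hf2]⟩
      | succ s ih =>
        obtain ⟨l, hl, h1, h2, h3, h4⟩ := ih
        refine ⟨f (p^[m+s+1] v) :: l, by simp, ?_, ?_, ?_, ?_⟩
        · intro e he
          rcases List.mem_cons.mp he with rfl | he
          · exact hf1 _
          · exact h1 e he
        · cases l with
          | nil => exact absurd rfl hl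
          | cons y l =>
            rw [List.isChain_cons_cons]
            refine ⟨?_, h2⟩
            rw [hf2]; exact h3.symm
        · exact hf3 _
        · rw [List.getLast_cons hl]; exact h4
    obtain ⟨l, hl, h1, h2, h3, h4⟩ := aux s
    refine ⟨l, hl, h1, h2, ?_⟩
    intro x hx y hy
    rw [List.head?_eq_some_head hl] at hx
    rw [List.getLast?_eq_some_getLast hl] at hy
    simp only [Option.mem_def, Option.some.injEq] at hx hy
    rw [← hx, ← hy, h3, h4]
    exact heq

lemma matrix_tree {V E : Type} [Fintype V] [Fintype E] [DecidableEq V]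
    (G : Multidigraph V E) (w : E → ℤ) (r : V) :
    ((treeCount G w r : ℤ) : ℚ) = (lapM G (fun e => (w e : ℚ)) r).det := by
  classical
  let A : V → Finset (Option E) := fun v => if v = r then {none} else
    (univ.filter (fun e => G.tgt e = v)).map Function.Embedding.some
  let cf : Option E → ℚ := fun o => o.elim 1 (fun e => (w e : ℚ))
  let row : V → Option E → V → ℚ := fun v o u =>
    (if u = v then 1 else 0) - o.elim 0 (fun e => if u = G.src e then 1 else 0)
  have hlap : (lapM G (fun e => (w e : ℚ)) r) =
      (fun v => ∑ o ∈ A v, cf o • row v o) := by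
    ext v u
    by_cases hv : v = r
    · simp [lapM, hv, A, cf, row]
    · simp [lapM, hv, A, cf, row, Finset.sum_filter, Finset.sum_apply]
      
  have hdet : (lapM G (fun e => (w e : ℚ)) r).det =
      ∑ f ∈ Fintype.piFinset A, (∏ v, cf (f v)) * (Matrix.of (fun v => row v (f v))).det := by
    rw [hlap]
    have := (Matrix.detRowAlternating (n := V) (R := ℚ)).toMultilinearMap.map_sum_finset
      (fun v o => cf o • row v o) A
    refine this.trans (Finset.sum_congr rfl fun f _ => ?_)
    have h2 := (Matrix.detRowAlternating (n := V) (R := ℚ)).toMultilinearMap.map_smul_univ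
      (fun v => cf (f v)) (fun v => row v (f v))
    exact h2
  rw [hdet]
  have htc : ((treeCount G w r : ℤ) : ℚ) =
      ∑ T ∈ univ.filter (fun T : Finset E =>
        (∀ v : V, v ≠ r → (T.filter (fun e => G.tgt e = v)).card = 1) ∧
        (T.filter (fun e => G.tgt e = r)).card = 0), 
        (∏ e ∈ T, (w e : ℚ)) * (if Acyc G T then 1 else 0) := by
    unfold treeCount
    rw [Finset.sum_filter]
    push_cast
    refine Finset.sum_congr rfl fun T _ => ?_
    have : IsOrientedSpanningTree G r T ↔ ((∀ v : V, v ≠ r → (T.filter (fun e => G.tgt e = v)).card = 1) ∧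
        (T.filter (fun e => G.tgt e = r)).card = 0) ∧ Acyc G T := by
      unfold IsOrientedSpanningTree Acyc
      rw [and_assoc]
      rfl
    by_cases h1 : ((∀ v : V, v ≠ r → (T.filter (fun e => G.tgt e = v)).card = 1) ∧
        (T.filter (fun e => G.tgt e = r)).card = 0) <;> by_cases h2 : Acyc G T <;>
      simp only [this, h1, h2, and_self, and_true, and_false, if_true, if_false, mul_one, mul_zero,
        ite_self]
  rw [htc]
  symm
  have hA : ∀ f ∈ Fintype.piFinset A, f r = none ∧ ∀ v, v ≠ r → ∃ e, f v = some e ∧ G.tgt e = v := by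
    intro f hf
    rw [Fintype.mem_piFinset] at hf
    refine ⟨by simpa [A] using hf r, fun v hv => ?_⟩
    have := hf v
    simp only [A, hv, if_false, Finset.mem_map, mem_filter, mem_univ, true_and] at this
    obtain ⟨e, he, he'⟩ := this
    exact ⟨e, he'.symm, he⟩
  have hfib : ∀ f ∈ Fintype.piFinset A, ∀ v e, f v = some e →
      ((univ.filter (fun e => f (G.tgt e) = some e)).filter (fun e => G.tgt e = v)) = {e} := by
    intro f hf v e hfe
    obtain ⟨h1, h2⟩ := hA f hf
    have hvr : v ≠ r := by rintro rfl; simp [h1] at hfe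
    obtain ⟨e', he', ht⟩ := h2 v hvr
    have : e' = e := by rw [he'] at hfe; simpa using hfe
    subst this
    ext x
    simp only [mem_filter, mem_univ, true_and, mem_singleton]
    constructor
    · rintro ⟨hx, hxv⟩
      rw [hxv, he'] at hx; simpa using hx.symm
    · rintro rfl; exact ⟨by rw [ht, he'], ht⟩
  have hfibn : ∀ f ∈ Fintype.piFinset A, ∀ v, f v = none →
      ((univ.filter (fun e => f (G.tgt e) = some e)).filter (fun e => G.tgt e = v)) = ∅ := by
    intro f hf v hfe
    ext x
    simp only [mem_filter, mem_univ, true_and, Finset.notMem_empty, iff_false]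
    rintro ⟨hx, rfl⟩
    rw [hfe] at hx; simp at hx
  refine Finset.sum_bij (fun f _ => univ.filter (fun e => f (G.tgt e) = some e)) ?_ ?_ ?_ ?_
  · intro f hf
    obtain ⟨h1, h2⟩ := hA f hf
    rw [mem_filter]
    refine ⟨mem_univ _, fun v hv => ?_, ?_⟩
    · obtain ⟨e, he, _⟩ := h2 v hv
      rw [hfib f hf v e he]; simp
    · rw [hfibn f hf r h1]; simp
  · intro f hf g hg hfg
    obtain ⟨h1, h2⟩ := hA f hf
    obtain ⟨h1', h2'⟩ := hA g hg
    ext1 v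
    by_cases hv : v = r
    · rw [hv, h1, h1']
    · obtain ⟨e, he, ht⟩ := h2 v hv
      have : e ∈ univ.filter (fun e => f (G.tgt e) = some e) := by simp [ht, he]
      rw [hfg] at this
      simp only [mem_filter, mem_univ, true_and, ht] at this
      rw [he, this]
  · intro T hT
    rw [mem_filter] at hT
    obtain ⟨-, hT1, hT0⟩ := hT
    have hT2 : ∀ v, v ≠ r → ∃ e, T.filter (fun e => G.tgt e = v) = {e} := fun v hv =>
      Finset.card_eq_one.mp (hT1 v hv)
    have hT3 := Finset.card_eq_zero.mp hT0
    by_cases hE : Nonempty E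
    · choose! g hg using hT2
      have hg' : ∀ v, v ≠ r → ∀ e, (e ∈ T ∧ G.tgt e = v) ↔ e = g v := by
        intro v hv e
        have := congrArg (fun s => e ∈ s) (hg v hv)
        simpa using this
      refine ⟨fun v => if v = r then none else some (g v), ?_, ?_⟩
      · rw [Fintype.mem_piFinset]
        intro v
        by_cases hv : v = r
        · simp [A, hv]
        · simp [A, hv]
          exact ((hg' v hv (g v)).mpr rfl).2
      · ext e
        simp only [mem_filter, mem_univ, true_and]
        by_cases hv : G.tgt e = r
        · simp only [hv, if_true]
          have : e ∉ T.filter (fun e => G.tgt e = r) := by rw [hT3]; simp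
          simp [hv] at this
          simp [this]
        · simp only [hv, if_false, Option.some.injEq]
          have := hg' _ hv e
          simp at this
          rw [this]; exact eq_comm
    · refine ⟨fun _ => none, ?_, ?_⟩
      · rw [Fintype.mem_piFinset]
        intro v
        by_cases hv : v = r
        · simp [A, hv]
        · obtain ⟨e, _⟩ := hT2 v hv
          exact absurd ⟨e⟩ hE
      · ext e; exact absurd ⟨e⟩ hE
  · intro f hf
    obtain ⟨h1, h2⟩ := hA f hf
    congr 1
    · rw [← Finset.prod_fiberwise (univ.filter (fun e => f (G.tgt e) = some e)) G.tgt]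
      refine Finset.prod_congr rfl fun v _ => ?_
      cases hfv : f v with
      | none => rw [hfibn f hf v hfv]; simp [cf]
      | some e => rw [hfib f hf v e hfv]; simp [cf]
    · let p : V → V := fun v => (f v).elim r G.src
      rw [← det_acyc G r _ p (by simp [p, h1])]
      · congr 1
        ext v u
        by_cases hv : v = r
        · subst hv
          simp [row, parMat, h1, Matrix.one_apply, eq_comm]
        · obtain ⟨e, he, ht⟩ := h2 v hv
          have hv' : ¬ r = v := fun h => hv h.symm
          simp [row, parMat, he, Matrix.one_apply, eq_comm, p, hv']
      · intro e he
        simp only [mem_filter, mem_univ, true_and] at he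
        refine ⟨fun h => ?_, by simp [p, he]⟩
        rw [h, h1] at he; simp at he
      · intro v hv
        obtain ⟨e, he, ht⟩ := h2 v hv
        exact ⟨e, by simp [ht, he], ht⟩

end Helpers

section Helpers2

open Finset

lemma schur_det {V K : Type} [Fintype V] [DecidableEq V] [Fintype K] [DecidableEq K]
    (A : Matrix V V ℚ) (B : Matrix V K ℚ) (C : Matrix K V ℚ) (D : Matrix K K ℚ)
    (X : Matrix K V ℚ) (hX : C + D * X = 0) :
    (Matrix.fromBlocks A B C D).det = (A + B * X).det * D.det := by
  have h : Matrix.fromBlocks A B C D * Matrix.fromBlocks 1 0 X 1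
      = Matrix.fromBlocks (A + B * X) B 0 D := by
    rw [Matrix.fromBlocks_multiply]
    simp [hX]
  have h2 := congrArg Matrix.det h
  rw [Matrix.det_mul, Matrix.det_fromBlocks_zero₁₂, Matrix.det_fromBlocks_zero₂₁] at h2
  simpa using h2

/-- Add `x` to row `a` and `y` to row `b`. -/
def rowAdd {V : Type} [DecidableEq V] (K : Matrix V V ℚ) (a b : V) (x y : V → ℚ) :
    Matrix V V ℚ :=
  Matrix.of fun v u => K v u + (if v = a then x u else 0) + (if v = b then y u else 0)

lemma rowAdd_eq {V : Type} [Fintype V] [DecidableEq V] (K : Matrix V V ℚ) (a b : V) (hab : a ≠ b)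
    (x y : V → ℚ) :
    rowAdd K a b x y = (K.updateRow a (K a + x)).updateRow b (K b + y) := by
  ext v u
  by_cases hb : v = b
  · subst hb
    simp [rowAdd, hab.symm]
  · by_cases ha : v = a
    · subst ha
      simp [rowAdd, hb]
    · simp [rowAdd, ha, hb]

lemma det_skein {V : Type} [Fintype V] [DecidableEq V] (K : Matrix V V ℚ) (a b : V) (hab : a ≠ b)
    (A B c d : V → ℚ) (s t i j : ℚ) (hij : i + j ≠ 0) :
    j * (rowAdd K a b (s • (j • A - j • d)) (t • (i • B - i • c))).det =
      -i * (rowAdd K a b (s • (j • A - j • c)) (t • (i • B - (j • d + (i - j) • c)))).det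
      + (i + j) * (rowAdd K a b (s • (j • A - (j / (i + j)) • (i • c + j • d)))
          (t • (i • B - (i / (i + j)) • (i • c + j • d)))).det := by
  simp only [rowAdd_eq K a b hab]
  let P : (V → ℚ) → (V → ℚ) → ℚ := fun x y => ((K.updateRow a x).updateRow b y).det
  have hP : ∀ x y, ((K.updateRow a x).updateRow b y).det = P x y := fun _ _ => rfl
  have hP' : ∀ x y, P x y = ((K.updateRow b y).updateRow a x).det := fun x y => by
    rw [← hP, Matrix.updateRow_comm _ hab]
  simp only [hP]
  have al : ∀ x x' y, P (x + x') y = P x y + P x' y := fun x x' y => by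
    simp only [hP', Matrix.det_updateRow_add]
  have ar : ∀ x y y', P x (y + y') = P x y + P x y' := fun x y y' => by
    simp only [← hP, Matrix.det_updateRow_add]
  have ml : ∀ (q : ℚ) x y, P (q • x) y = q * P x y := fun q x y => by
    simp only [hP', Matrix.det_updateRow_smul]
  have mr : ∀ (q : ℚ) x y, P x (q • y) = q * P x y := fun q x y => by
    simp only [← hP, Matrix.det_updateRow_smul]
  have nl : ∀ x x' y, P (x - x') y = P x y - P x' y := fun x x' y => by
    have := ml (-1) x' y
    rw [sub_eq_add_neg, al, show -x' = (-1 : ℚ) • x' by simp, this]; ring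
  have nr : ∀ x y y', P x (y - y') = P x y - P x y' := fun x y y' => by
    have := mr (-1) x y'
    rw [sub_eq_add_neg, ar, show -y' = (-1 : ℚ) • y' by simp, this]; ring
  have alt : ∀ x, P x x = 0 := fun x => by
    rw [← hP]
    apply Matrix.det_zero_of_row_eq hab
    ext u
    simp [Matrix.updateRow_apply, hab]
  have hsw : P d c = - P c d := by
    have := alt (c + d)
    rw [al, ar, ar, alt, alt] at this
    linarith
  simp only [al, ar, ml, mr, nl, nr, alt, hsw]
  field_simp
  ring

lemma sum_split {E : Type} [Fintype E] [DecidableEq E] (e₁ e₂ : E) (he : e₁ ≠ e₂) (F : E → ℚ) :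
    ∑ e, F e = ∑ e : {e : E // e ≠ e₁ ∧ e ≠ e₂}, F e.1 + F e₁ + F e₂ := by
  have h1 : ∑ e : {e : E // e ≠ e₁ ∧ e ≠ e₂}, F e.1
      = ∑ e ∈ univ.filter (fun e => e ≠ e₁ ∧ e ≠ e₂), F e :=
    (Finset.sum_subtype (univ.filter (fun e => e ≠ e₁ ∧ e ≠ e₂)) (by simp) F).symm
  rw [h1]
  have h2 : univ.filter (fun e => e ≠ e₁ ∧ e ≠ e₂) = (univ.erase e₁).erase e₂ := by
    ext e; simp [and_comm]
  rw [h2]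
  rw [← Finset.add_sum_erase univ F (mem_univ e₁),
    ← Finset.add_sum_erase (univ.erase e₁) F (by simp [he.symm] : e₂ ∈ univ.erase e₁)]
  ring

/-- The graph with the two distinguished edges deleted. -/
def baseG {V E : Type} (G : Multidigraph V E) (e₁ e₂ : E) :
    Multidigraph V {e : E // e ≠ e₁ ∧ e ≠ e₂} where
  src e := G.src e.1
  tgt e := G.tgt e.1

/-- Indicator vector. -/
def ind {V : Type} [DecidableEq V] (a : V) : V → ℚ := fun u => if u = a then 1 else 0

/-- Indicator of not being the root. -/
def nr {V : Type} [DecidableEq V] (r a : V) : ℚ := if a = r then 0 else 1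

lemma lap_G {V E : Type} [Fintype V] [Fintype E] [DecidableEq V] [DecidableEq E]
    (G : Multidigraph V E) (w : E → ℚ) (i j : ℚ) (a b c d : V) (hab : a ≠ b)
    (e₁ e₂ : E) (he : e₁ ≠ e₂)
    (h1s : G.src e₁ = c) (h1t : G.tgt e₁ = b) (h1w : w e₁ = i)
    (h2s : G.src e₂ = d) (h2t : G.tgt e₂ = a) (h2w : w e₂ = j) (r : V) :
    lapM G w r = rowAdd (lapM (baseG G e₁ e₂) (fun e => w e.1) r) a b
      (nr r a • (j • ind a - j • ind d)) (nr r b • (i • ind b - i • ind c)) := by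
  ext v u
  by_cases hv : v = r
  · subst hv
    by_cases ha : v = a
    · subst ha; simp [lapM, rowAdd, nr, hab]
    · by_cases hb : v = b
      · subst hb; simp [lapM, rowAdd, nr, ha]
      · simp [lapM, rowAdd, ha, hb]
  · have hL : lapM G w r v u = lapM (baseG G e₁ e₂) (fun e => w e.1) r v u
        + (if b = v then i * ((if u = v then 1 else 0) - (if u = c then 1 else 0)) else 0)
        + (if a = v then j * ((if u = v then 1 else 0) - (if u = d then 1 else 0)) else 0) := by
      simp only [lapM, Matrix.of_apply, hv, if_false]
      rw [sum_split e₁ e₂ he, h1s, h1t, h1w, h2s, h2t, h2w]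
      rfl
    rw [hL]
    simp only [rowAdd, Matrix.of_apply]
    generalize lapM (baseG G e₁ e₂) (fun e => w e.1) r v u = S
    by_cases ha : v = a
    · subst ha; simp [nr, hab, hab.symm, hv, ind, mul_sub]
    · by_cases hb : v = b
      · subst hb; simp [nr, Ne.symm ha, ha, hv, ind, mul_sub]
      · simp [ha, hb, Ne.symm ha, Ne.symm hb]

lemma lap_G1 {V E : Type} [Fintype V] [Fintype E] [DecidableEq V] [DecidableEq E]
    (G : Multidigraph V E) (w : E → ℤ) (i j : ℤ) (a b c d : V) (hab : a ≠ b)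
    (e₁ e₂ : E) (r : V) (hi : i ≠ 0) :
    (lapM (Gamma1 G e₁ e₂ a b c d) (fun e => (weight1 w e₁ e₂ i j e : ℚ)) (Sum.inl r)).det =
     (i : ℚ) ^ 2 * (rowAdd (lapM (baseG G e₁ e₂) (fun e => (w e.1 : ℚ)) r) a b
      (nr r a • ((j : ℚ) • ind a - (j : ℚ) • ind c))
      (nr r b • ((i : ℚ) • ind b - ((j : ℚ) • ind d + ((i : ℚ) - j) • ind c)))).det := by
  have hi' : (i : ℚ) ≠ 0 := by exact_mod_cast hi
  let A : Matrix V V ℚ := rowAdd (lapM (baseG G e₁ e₂) (fun e => (w e.1 : ℚ)) r) a b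
      (nr r a • ((j : ℚ) • ind a)) (nr r b • ((i : ℚ) • ind b))
  let B : Matrix V (Fin 2) ℚ := Matrix.of fun v =>
    ![if v = b then - (nr r b * i) else 0, if v = a then - (nr r a * j) else 0]
  let C : Matrix (Fin 2) V ℚ := Matrix.of ![-((j : ℚ) • ind d), - ((i : ℚ) • ind c)]
  let D : Matrix (Fin 2) (Fin 2) ℚ := !![(i : ℚ), -((i : ℚ) - j); 0, (i : ℚ)]
  let X : Matrix (Fin 2) V ℚ := Matrix.of ![(1 / (i : ℚ)) • ((j : ℚ) • ind d + ((i : ℚ) - j) • ind c), ind c]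
  have hS : ∀ v u : V, v ≠ r → (∑ x : {e : E // e ≠ e₁ ∧ e ≠ e₂},
      if (Gamma1 G e₁ e₂ a b c d).tgt (Sum.inl x) = Sum.inl v then
        (weight1 w e₁ e₂ i j (Sum.inl x) : ℚ) * ((if (Sum.inl u : V ⊕ Fin 2) = Sum.inl v then 1 else 0)
          - (if Sum.inl u = (Gamma1 G e₁ e₂ a b c d).src (Sum.inl x) then 1 else 0)) else 0)
      = lapM (baseG G e₁ e₂) (fun e => (w e.1 : ℚ)) r v u := by
    intro v u hv
    simp only [lapM, Matrix.of_apply, hv, if_false]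
    refine Finset.sum_congr rfl fun x _ => ?_
    by_cases h1 : G.tgt x.1 = v <;> by_cases h2 : u = G.src x.1 <;> by_cases h3 : u = v <;>
      simp [Gamma1, weight1, baseG, h1, h2, h3]
  have hL : lapM (Gamma1 G e₁ e₂ a b c d) (fun e => (weight1 w e₁ e₂ i j e : ℚ)) (Sum.inl r)
      = Matrix.fromBlocks A B C D := by
    ext v u
    rcases v with v | v
    · by_cases hv : v = r
      · subst hv
        rcases u with u | u
        · by_cases ha : v = a
          · subst ha; simp [A, lapM, rowAdd, nr, hab]
          · by_cases hb : v = b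
            · subst hb; simp [A, lapM, rowAdd, nr, ha]
            · simp [A, lapM, rowAdd, ha, hb]
        · by_cases ha : v = a
          · subst ha; fin_cases u <;> simp [B, lapM, nr, hab]
          · by_cases hb : v = b
            · subst hb; fin_cases u <;> simp [B, lapM, nr, ha]
            · fin_cases u <;> simp [B, lapM, ha, hb]
      · simp only [lapM, Matrix.of_apply, Sum.inl.injEq, hv, if_false]
        rw [Fintype.sum_sum_type, Fin.sum_univ_five]
        rcases u with u | u
        · refine (congrArg₂ (· + ·) (hS v u hv) rfl).trans ?_
          simp only [A, Matrix.fromBlocks_apply₁₁, rowAdd, Matrix.of_apply]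
          generalize lapM (baseG G e₁ e₂) (fun e => (w e.1 : ℚ)) r v u = S
          by_cases ha : v = a
          · subst ha; simp [Gamma1, weight1, nr, hab, hab.symm, hv, ind]
          · by_cases hb : v = b
            · subst hb; simp [Gamma1, weight1, nr, Ne.symm ha, ha, hv, ind]
            · simp [Gamma1, weight1, hv, ha, hb, Ne.symm ha, Ne.symm hb]
        · by_cases ha : v = a
          · subst ha; fin_cases u <;> simp [B, Gamma1, weight1, nr, hab, hab.symm, hv]
          · by_cases hb : v = b
            · subst hb; fin_cases u <;> simp [B, Gamma1, weight1, nr, Ne.symm ha, ha, hv]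
            · fin_cases u <;> simp [B, Gamma1, weight1, hv, ha, hb, Ne.symm ha, Ne.symm hb]
    · simp only [lapM, Matrix.of_apply, reduceCtorEq, if_false]
      rw [Fintype.sum_sum_type, Fin.sum_univ_five]
      rcases u with u | u
      · fin_cases v <;> simp [C, Gamma1, weight1, ind]
      · fin_cases v <;> fin_cases u <;> simp [D, Gamma1, weight1]
  rw [hL, schur_det A B C D X]
  · have hD : D.det = (i : ℚ) ^ 2 := by simp [D, Matrix.det_fin_two]; ring
    rw [hD, mul_comm]
    congr 2
    ext v u
    by_cases ha : v = a
    · subst ha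
      simp [A, B, X, rowAdd, hab, Matrix.mul_apply]; ring
    · by_cases hb : v = b
      · subst hb
        simp [A, B, X, rowAdd, ha, Matrix.mul_apply]; field_simp; ring
      · simp [A, B, X, rowAdd, ha, hb, Matrix.mul_apply]
  · ext v u
    fin_cases v
    · simp [C, D, X, Matrix.mul_apply]; field_simp; ring
    · simp [C, D, X, Matrix.mul_apply]

lemma lap_G2 {V E : Type} [Fintype V] [Fintype E] [DecidableEq V] [DecidableEq E]
    (G : Multidigraph V E) (w : E → ℤ) (i j : ℤ) (a b c d : V) (hab : a ≠ b)
    (e₁ e₂ : E) (r : V) (hij : (i : ℚ) + j ≠ 0) :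
    (lapM (Gamma2 G e₁ e₂ a b c d) (fun e => (weight2 w e₁ e₂ i j e : ℚ)) (Sum.inl r)).det =
     ((i : ℚ) + j) ^ 2 * (rowAdd (lapM (baseG G e₁ e₂) (fun e => (w e.1 : ℚ)) r) a b
      (nr r a • ((j : ℚ) • ind a - ((j : ℚ) / (i + j)) • ((i : ℚ) • ind c + (j : ℚ) • ind d)))
      (nr r b • ((i : ℚ) • ind b - ((i : ℚ) / (i + j)) • ((i : ℚ) • ind c + (j : ℚ) • ind d)))).det := by
  let A : Matrix V V ℚ := rowAdd (lapM (baseG G e₁ e₂) (fun e => (w e.1 : ℚ)) r) a b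
      (nr r a • ((j : ℚ) • ind a)) (nr r b • ((i : ℚ) • ind b))
  let B : Matrix V (Fin 2) ℚ := Matrix.of fun v =>
    ![0, (if v = a then - (nr r a * j) else 0) + (if v = b then - (nr r b * i) else 0)]
  let C : Matrix (Fin 2) V ℚ := Matrix.of ![-((i : ℚ) • ind c + (j : ℚ) • ind d), 0]
  let D : Matrix (Fin 2) (Fin 2) ℚ := !![(i : ℚ) + j, 0; -((i : ℚ) + j), (i : ℚ) + j]
  let X : Matrix (Fin 2) V ℚ := Matrix.of ![(1 / ((i : ℚ) + j)) • ((i : ℚ) • ind c + (j : ℚ) • ind d),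
    (1 / ((i : ℚ) + j)) • ((i : ℚ) • ind c + (j : ℚ) • ind d)]
  have hS : ∀ v u : V, v ≠ r → (∑ x : {e : E // e ≠ e₁ ∧ e ≠ e₂},
      if (Gamma2 G e₁ e₂ a b c d).tgt (Sum.inl x) = Sum.inl v then
        (weight2 w e₁ e₂ i j (Sum.inl x) : ℚ) * ((if (Sum.inl u : V ⊕ Fin 2) = Sum.inl v then 1 else 0)
          - (if Sum.inl u = (Gamma2 G e₁ e₂ a b c d).src (Sum.inl x) then 1 else 0)) else 0)
      = lapM (baseG G e₁ e₂) (fun e => (w e.1 : ℚ)) r v u := by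
    intro v u hv
    simp only [lapM, Matrix.of_apply, hv, if_false]
    refine Finset.sum_congr rfl fun x _ => ?_
    by_cases h1 : G.tgt x.1 = v <;> by_cases h2 : u = G.src x.1 <;> by_cases h3 : u = v <;>
      simp [Gamma2, weight2, baseG, h1, h2, h3]
  have hL : lapM (Gamma2 G e₁ e₂ a b c d) (fun e => (weight2 w e₁ e₂ i j e : ℚ)) (Sum.inl r)
      = Matrix.fromBlocks A B C D := by
    ext v u
    rcases v with v | v
    · by_cases hv : v = r
      · subst hv
        rcases u with u | u
        · by_cases ha : v = a
          · subst ha; simp [A, lapM, rowAdd, nr, hab]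
          · by_cases hb : v = b
            · subst hb; simp [A, lapM, rowAdd, nr, ha]
            · simp [A, lapM, rowAdd, ha, hb]
        · by_cases ha : v = a
          · subst ha; fin_cases u <;> simp [B, lapM, nr, hab]
          · by_cases hb : v = b
            · subst hb; fin_cases u <;> simp [B, lapM, nr, ha]
            · fin_cases u <;> simp [B, lapM, ha, hb]
      · simp only [lapM, Matrix.of_apply, Sum.inl.injEq, hv, if_false]
        rw [Fintype.sum_sum_type, Fin.sum_univ_five]
        rcases u with u | u
        · refine (congrArg₂ (· + ·) (hS v u hv) rfl).trans ?_
          simp only [A, Matrix.fromBlocks_apply₁₁, rowAdd, Matrix.of_apply]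
          generalize lapM (baseG G e₁ e₂) (fun e => (w e.1 : ℚ)) r v u = S
          by_cases ha : v = a
          · subst ha; simp [Gamma2, weight2, nr, hab, hab.symm, hv, ind]
          · by_cases hb : v = b
            · subst hb; simp [Gamma2, weight2, nr, Ne.symm ha, ha, hv, ind]
            · simp [Gamma2, weight2, hv, ha, hb, Ne.symm ha, Ne.symm hb]
        · by_cases ha : v = a
          · subst ha; fin_cases u <;> simp [B, Gamma2, weight2, nr, hab, hab.symm, hv]
          · by_cases hb : v = b
            · subst hb; fin_cases u <;> simp [B, Gamma2, weight2, nr, Ne.symm ha, ha, hv]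
            · fin_cases u <;> simp [B, Gamma2, weight2, hv, ha, hb, Ne.symm ha, Ne.symm hb]
    · simp only [lapM, Matrix.of_apply, reduceCtorEq, if_false]
      rw [Fintype.sum_sum_type, Fin.sum_univ_five]
      rcases u with u | u
      · fin_cases v <;> simp [C, Gamma2, weight2, ind, add_comm]
      · fin_cases v <;> fin_cases u <;> simp [D, Gamma2, weight2]
  rw [hL, schur_det A B C D X]
  · have hD : D.det = ((i : ℚ) + j) ^ 2 := by simp [D, Matrix.det_fin_two]; ring
    rw [hD, mul_comm]
    congr 2
    ext v u
    by_cases ha : v = a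
    · subst ha
      simp [A, B, X, rowAdd, hab, Matrix.mul_apply]; field_simp; ring
    · by_cases hb : v = b
      · subst hb
        simp [A, B, X, rowAdd, ha, Matrix.mul_apply]; field_simp; ring
      · simp [A, B, X, rowAdd, ha, hb, Matrix.mul_apply]
  · ext v u
    fin_cases v
    · simp [C, D, X, Matrix.mul_apply]; field_simp; ring
    · simp [C, D, X, Matrix.mul_apply]; ring

end Helpers2

/-- **Skein relation, case `i > j`.** For a finite connected directed multigraph `Γ`
with a positive balanced weight, distinct vertices `a, b, c, d`, and distinguished
edges `e₁ : c → b` of weight `i` and `e₂ : d → a` of weight `j` with `i > j`,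
the weighted numbers of oriented spanning trees rooted at any vertex `r` of `Γ`
satisfy `i·j·(i+j)·N(Γ, r) = -(i+j)·N(Γ₁, r) + i·N(Γ₂, r)`. -/
theorem skein_relation_gt {V E : Type} [Fintype V] [Fintype E] [DecidableEq V] [DecidableEq E]
    (G : Multidigraph V E) (w : E → ℤ)
    (hconn : MConnected G) (hbal : IsBalanced G w) (hpos : ∀ e, 0 < w e)
    (i j : ℤ) (hi : 0 < i) (hj : 0 < j) (hij : j < i)
    (a b c d : V)
    (hab : a ≠ b) (hac : a ≠ c) (had : a ≠ d) (hbc : b ≠ c) (hbd : b ≠ d) (hcd : c ≠ d)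
    (e₁ e₂ : E) (he : e₁ ≠ e₂)
    (h1s : G.src e₁ = c) (h1t : G.tgt e₁ = b) (h1w : w e₁ = i)
    (h2s : G.src e₂ = d) (h2t : G.tgt e₂ = a) (h2w : w e₂ = j)
    (r : V) :
    i * j * (i + j) * treeCount G w r
      = -(i + j) * treeCount (Gamma1 G e₁ e₂ a b c d) (weight1 w e₁ e₂ i j) (Sum.inl r)
        + i * treeCount (Gamma2 G e₁ e₂ a b c d) (weight2 w e₁ e₂ i j) (Sum.inl r) := by
  have hi' : (i : ℚ) ≠ 0 := by exact_mod_cast hi.ne'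
  have hij' : (i : ℚ) + j ≠ 0 := by
    have : i + j ≠ 0 := by omega
    exact_mod_cast this
  have key : ((i * j * (i + j) * treeCount G w r : ℤ) : ℚ)
      = ((-(i + j) * treeCount (Gamma1 G e₁ e₂ a b c d) (weight1 w e₁ e₂ i j) (Sum.inl r)
        + i * treeCount (Gamma2 G e₁ e₂ a b c d) (weight2 w e₁ e₂ i j) (Sum.inl r) : ℤ) : ℚ) := by
    push_cast
    rw [matrix_tree, matrix_tree, matrix_tree,
      lap_G G (fun e => (w e : ℚ)) i j a b c d hab e₁ e₂ he h1s h1t (by rw [h1w]) h2s h2t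
        (by rw [h2w]) r,
      lap_G1 G w i j a b c d hab e₁ e₂ r hi.ne',
      lap_G2 G w i j a b c d hab e₁ e₂ r hij']
    have := det_skein (lapM (baseG G e₁ e₂) (fun e => (w e.1 : ℚ)) r) a b hab
      (ind a) (ind b) (ind c) (ind d) (nr r a) (nr r b) i j hij'
    linear_combination ((i : ℚ) * (i + j)) * this
  exact_mod_cast key
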